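/- There exists a constant C > 0 such that for every u ∈ C_c^∞(ℝ^d): ( ∫_{ℝ^d} u² dμ )^{(d+α)/d} ≤ C·D(u,u)·( ∫_{ℝ^d} |u(x)|·(1 + |x|)^{−β(d−α)/(2α)} μ(dx) )^{2α/d}. -/

import Mathlib

open MeasureTheory

/-- The fractional Dirichlet energy
`D(f,f) = ∫∫ (f(x) − f(y))² / |x − y|^{d+α} dx dy` on `ℝ^d`. -/
noncomputable def fracD (d : ℕ) (α : ℝ) (f : EuclideanSpace ℝ (Fin d) → ℝ) : ℝ :=
  ∫ x, ∫ y, (f x - f y) ^ 2 / ‖x - y‖ ^ ((d : ℝ) + α)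


theorem wn_holder {X : Type*} [MeasurableSpace X] {μ : Measure X} {f g : X → ℝ}
    (hf : Integrable f μ) (hg : Integrable g μ) (hf0 : ∀ x, 0 ≤ f x) (hg0 : ∀ x, 0 ≤ g x)
    {a b : ℝ} (ha : 0 < a) (hb : 0 < b) (hab : a + b = 1) :
    ∫ x, f x ^ a * g x ^ b ∂μ ≤ (∫ x, f x ∂μ) ^ a * (∫ x, g x ∂μ) ^ b := by
  have hF : 0 ≤ ∫ x, f x ∂μ := integral_nonneg hf0
  have hG : 0 ≤ ∫ x, g x ∂μ := integral_nonneg hg0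
  have key := ENNReal.lintegral_mul_norm_pow_le (μ := μ) (f := fun x => ENNReal.ofReal (f x))
    (g := fun x => ENNReal.ofReal (g x)) hf.aemeasurable.ennreal_ofReal
    hg.aemeasurable.ennreal_ofReal ha.le hb.le hab
  rw [← ofReal_integral_eq_lintegral_ofReal hf (Filter.Eventually.of_forall hf0),
    ← ofReal_integral_eq_lintegral_ofReal hg (Filter.Eventually.of_forall hg0),
    ENNReal.ofReal_rpow_of_nonneg hF ha.le, ENNReal.ofReal_rpow_of_nonneg hG hb.le,
    ← ENNReal.ofReal_mul (by positivity)] at key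
  rw [integral_eq_lintegral_of_nonneg_ae]
  · refine ENNReal.toReal_le_of_le_ofReal (by positivity) (le_trans (le_of_eq ?_) key)
    refine lintegral_congr fun x => ?_
    rw [ENNReal.ofReal_mul (Real.rpow_nonneg (hf0 x) _), ENNReal.ofReal_rpow_of_nonneg (hf0 x) ha.le,
      ENNReal.ofReal_rpow_of_nonneg (hg0 x) hb.le]
  · exact Filter.Eventually.of_forall fun x =>
      mul_nonneg (Real.rpow_nonneg (hf0 x) _) (Real.rpow_nonneg (hg0 x) _)
  · exact ((hf.aemeasurable.pow_const a).mul (hg.aemeasurable.pow_const b)).aestronglyMeasurable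

theorem wn_phi (d : ℕ) (α : ℝ) (hα : 0 < α) (hα2 : α < 2) (hd : α < d) :
    Integrable (fun z : EuclideanSpace ℝ (Fin d) => min 1 (‖z‖ ^ 2) / ‖z‖ ^ ((d : ℝ) + α)) := by
  have hd0 : 0 < d := by exact_mod_cast hα.trans hd
  have : NeZero d := ⟨hd0.ne'⟩
  have : Nontrivial (EuclideanSpace ℝ (Fin d)) := by
    apply Module.nontrivial_of_finrank_pos (R := ℝ); simpa using hd0
  rw [integrable_fun_norm_addHaar volume (f := fun r : ℝ => min 1 (r ^ 2) / r ^ ((d : ℝ) + α))]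
  have e : Set.Ioi (0:ℝ) = Set.Ioo 0 1 ∪ Set.Ici 1 := by
    rw [Set.Ioo_union_Ici_eq_Ioi one_pos]
  have hdim : Module.finrank ℝ (EuclideanSpace ℝ (Fin d)) = d := by simp
  have hpow : ∀ r : ℝ, 0 < r → r ^ (d - 1) = r ^ ((d:ℝ) - 1) := by
    intro r hr
    rw [← Real.rpow_natCast, Nat.cast_sub hd0]; simp
  rw [hdim, e]
  refine IntegrableOn.union ?_ ?_
  · refine ((intervalIntegral.integrableOn_Ioo_rpow_iff (s := 1 - α) one_pos).2 (by linarith)).congr_fun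
      ?_ measurableSet_Ioo
    intro r hr
    have h1 : r ^ 2 ≤ 1 := pow_le_one₀ hr.1.le hr.2.le
    simp only [smul_eq_mul]
    rw [min_eq_right h1, hpow r hr.1, ← Real.rpow_natCast r 2, ← Real.rpow_sub hr.1, ← Real.rpow_add hr.1]
    congr 1; push_cast; ring
  · rw [integrableOn_Ici_iff_integrableOn_Ioi]
    refine (integrableOn_Ioi_rpow_of_lt (a := -1 - α) (by linarith) one_pos).congr_fun
      ?_ measurableSet_Ioi
    intro r hr
    have hr1 : 1 < r := hr
    have hr0 : 0 < r := one_pos.trans hr1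
    have h1 : 1 ≤ r ^ 2 := one_le_pow₀ hr1.le
    simp only [smul_eq_mul]
    rw [min_eq_left h1, hpow r hr0, one_div, ← Real.rpow_neg hr0.le, ← Real.rpow_add hr0]
    congr 1; ring

theorem wn_scalar (a ω : ℝ) (ha : 0 < a) (ha1 : a < 1) (hω : 0 < ω) :
    ∃ C > (0:ℝ), ∀ X G I : ℝ, 0 ≤ X → 0 ≤ G → 0 < I →
      (∀ t : ℝ, 0 < t → X * (ω * t) ≤ 2 * (t ^ (1 + a) * G) + 2 * ((ω * t) ^ a * I ^ (1 - a))) →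
      X ^ (1 / (1 - a)) ≤ C * I ^ a * G := by
  set c : ℝ := (2 + 2 * ω ^ a) / ω with hc
  have hc0 : 0 < c := by positivity
  have h1a : 0 < 1 - a := by linarith
  refine ⟨c ^ (1 / (1 - a)), by positivity, ?_⟩
  intro X G I hX hG hI h
  have main : ∀ G' : ℝ, G < G' → X ^ (1 / (1 - a)) ≤ c ^ (1 / (1 - a)) * I ^ a * G' := by
    intro G' hG'
    have hG0 : 0 < G' := hG.trans_lt hG'
    set t : ℝ := I ^ (1 - a) / G' with ht
    have ht0 : 0 < t := by positivity
    have hIt : I ^ (1 - a) = t * G' := by rw [ht]; field_simp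
    have h2 := h t ht0
    have h3 : X * (ω * t) ≤ (c * (t ^ a * G')) * (ω * t) := by
      refine h2.trans ?_
      have : t ^ (1 + a) * G ≤ t ^ (1 + a) * G' := by gcongr
      refine (add_le_add_left (mul_le_mul_of_nonneg_left this two_pos.le) _).trans (le_of_eq ?_)
      rw [hIt, Real.mul_rpow hω.le ht0.le, Real.rpow_add ht0, Real.rpow_one, hc]
      field_simp
    have h4 : X ≤ c * (t ^ a * G') := le_of_mul_le_mul_right h3 (by positivity)
    have h5 : t ^ a * G' = (I ^ a * G') ^ (1 - a) := by
      rw [ht, Real.div_rpow (by positivity) hG0.le, ← Real.rpow_mul hI.le,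
        Real.mul_rpow (by positivity) hG0.le, ← Real.rpow_mul hI.le, Real.rpow_sub hG0, Real.rpow_one,
        mul_comm a (1 - a)]
      field_simp
    rw [h5] at h4
    calc X ^ (1 / (1 - a)) ≤ (c * (I ^ a * G') ^ (1 - a)) ^ (1 / (1 - a)) := by gcongr
      _ = _ := by
        rw [Real.mul_rpow hc0.le (by positivity), ← Real.rpow_mul (by positivity),
          mul_one_div_cancel h1a.ne', Real.rpow_one, mul_assoc]
  have hpos : 0 < c ^ (1 / (1 - a)) * I ^ a := by positivity
  rw [← div_le_iff₀' hpos]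
  refine le_of_forall_gt_imp_ge_of_dense fun G' hG' => ?_
  rw [div_le_iff₀' hpos]
  exact main G' hG'

theorem wn_kernel (d : ℕ) (α : ℝ) (hα : 0 < α) (hα2 : α < 2) (hd : α < d)
    (u : EuclideanSpace ℝ (Fin d) → ℝ) (hu : ContDiff ℝ (⊤ : ℕ∞) u) (hc : HasCompactSupport u) :
    Integrable (fun p : EuclideanSpace ℝ (Fin d) × EuclideanSpace ℝ (Fin d) =>
      (u p.1 - u p.2) ^ 2 / ‖p.1 - p.2‖ ^ ((d : ℝ) + α)) (volume.prod volume) ∧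
    ∀ x, Integrable (fun y => (u x - u y) ^ 2 / ‖x - y‖ ^ ((d : ℝ) + α)) := by
  have hphi := wn_phi d α hα hα2 hd
  set φ : EuclideanSpace ℝ (Fin d) → ℝ := fun z => min 1 (‖z‖ ^ 2) / ‖z‖ ^ ((d : ℝ) + α) with hφ
  have hφ0 : ∀ z, 0 ≤ φ z := fun z => by simp only [hφ]; positivity
  have hφe : ∀ x y, φ (y - x) = φ (x - y) := fun x y => by simp only [hφ, norm_sub_rev]
  obtain ⟨A, hA⟩ := hc.exists_bound_of_continuous hu.continuous
  obtain ⟨L, hL⟩ := hu.lipschitzWith_of_hasCompactSupport hc (by simp)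
  set M : ℝ := max (4 * A ^ 2) ((L:ℝ) ^ 2) with hM
  have hM0 : 0 ≤ M := le_max_of_le_right (by positivity)
  have hb : ∀ x y, (u x - u y) ^ 2 / ‖x - y‖ ^ ((d : ℝ) + α) ≤ M * φ (x - y) := by
    intro x y
    simp only [hφ]
    rw [← mul_div_assoc]
    gcongr
    rw [mul_min_of_nonneg _ _ hM0]
    apply le_min
    · have h1 := hA x
      have h2 := hA y
      rw [Real.norm_eq_abs, abs_le] at h1 h2
      refine le_trans ?_ (le_of_le_of_eq (le_max_left _ _) (mul_one M).symm)
      have : |u x - u y| ≤ 2 * A := by rw [abs_le]; constructor <;> linarith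
      calc (u x - u y) ^ 2 = |u x - u y| ^ 2 := (sq_abs _).symm
        _ ≤ (2 * A) ^ 2 := by gcongr
        _ = 4 * A ^ 2 := by ring
    · have h1 := hL.dist_le_mul x y
      rw [Real.dist_eq, dist_eq_norm] at h1
      calc (u x - u y) ^ 2 = |u x - u y| ^ 2 := (sq_abs _).symm
        _ ≤ ((L:ℝ) * ‖x - y‖) ^ 2 := by gcongr
        _ = (L:ℝ) ^ 2 * ‖x - y‖ ^ 2 := by ring
        _ ≤ _ := by gcongr; exact le_max_right _ _
  have hmeas : Measurable (fun p : EuclideanSpace ℝ (Fin d) × EuclideanSpace ℝ (Fin d) =>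
      (u p.1 - u p.2) ^ 2 / ‖p.1 - p.2‖ ^ ((d : ℝ) + α)) := by
    have := hu.continuous.measurable
    fun_prop
  have hnn : ∀ x y, 0 ≤ (u x - u y) ^ 2 / ‖x - y‖ ^ ((d : ℝ) + α) := fun x y => by positivity
  constructor
  · set B := tsupport u with hB
    have hBm : MeasurableSet B := (isClosed_tsupport u).measurableSet
    have hBi : Integrable (B.indicator (fun _ => (1:ℝ))) (volume : Measure (EuclideanSpace ℝ (Fin d))) :=
      (integrable_indicator_iff hBm).2 (integrableOn_const hc.isCompact.measure_lt_top.ne)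
    have i1 := hBi.convolution_integrand (ContinuousLinearMap.mul ℝ ℝ) hphi
    have i2 := i1.swap
    refine ((i1.add i2).const_mul M).mono' hmeas.aestronglyMeasurable (Filter.Eventually.of_forall ?_)
    rintro ⟨x, y⟩
    rw [Real.norm_of_nonneg (hnn x y)]
    simp only [Function.comp, Prod.swap, Pi.add_apply, ContinuousLinearMap.mul_apply']
    rw [hφe x y]
    have h0 := hφ0 (x - y)
    by_cases hx : x ∈ B
    · rw [Set.indicator_of_mem hx]
      refine (hb x y).trans ?_
      gcongr
      have : 0 ≤ B.indicator (fun _ => (1:ℝ)) y := Set.indicator_nonneg (fun _ _ => one_pos.le) _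
      nlinarith
    · by_cases hy : y ∈ B
      · rw [Set.indicator_of_mem hy, Set.indicator_of_notMem hx]
        refine (hb x y).trans (le_of_eq ?_)
        ring
      · rw [image_eq_zero_of_notMem_tsupport hx, image_eq_zero_of_notMem_tsupport hy,
          Set.indicator_of_notMem hx, Set.indicator_of_notMem hy]
        simp
  · intro x
    refine ((hphi.comp_sub_left x).const_mul M).mono'
      (hmeas.comp measurable_prodMk_left).aestronglyMeasurable (Filter.Eventually.of_forall ?_)
    intro y
    rw [Real.norm_of_nonneg (hnn x y)]
    exact hb x y

theorem wn_rpow_integrable (d : ℕ) (u : EuclideanSpace ℝ (Fin d) → ℝ)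
    (hu : Continuous u) (hc : HasCompactSupport u) (q : ℝ) (hq : 0 < q) :
    Integrable (fun x => (u x ^ 2) ^ q) := by
  refine Continuous.integrable_of_hasCompactSupport ?_ ?_
  · exact (hu.pow 2).rpow_const fun x => Or.inr hq.le
  · exact hc.comp_left (g := fun s : ℝ => (s ^ 2) ^ q) (by simp [Real.zero_rpow hq.ne'])

theorem wn_sobolev (d : ℕ) (α : ℝ) (hα : 0 < α) (hα2 : α < 2) (hd : α < d) :
    ∃ C > (0:ℝ), ∀ u : EuclideanSpace ℝ (Fin d) → ℝ,
      ContDiff ℝ (⊤ : ℕ∞) u → HasCompactSupport u →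
      (∫ x, (u x ^ 2) ^ (1 / (1 - α / d))) ^ (1 - α / d) ≤ C * fracD d α u := by
  have hd0 : 0 < (d:ℝ) := hα.trans hd
  have hdn : 0 < d := by exact_mod_cast hd0
  set a : ℝ := α / d with ha
  have ha0 : 0 < a := by positivity
  have ha1 : a < 1 := by rw [ha, div_lt_one hd0]; exact hd
  have h1a : 0 < 1 - a := by linarith
  set ω : ℝ := (volume : Measure (EuclideanSpace ℝ (Fin d))).real (Metric.ball 0 1) with hω
  have hω0 : 0 < ω := by
    rw [hω, measureReal_def]
    exact ENNReal.toReal_pos (Metric.measure_ball_pos volume _ one_pos).ne' measure_ball_lt_top.ne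
  obtain ⟨C, hC, hsc⟩ := wn_scalar a ω ha0 ha1 hω0
  refine ⟨C, hC, fun u hu hc => ?_⟩
  obtain ⟨hK, hKx⟩ := wn_kernel d α hα hα2 hd u hu hc
  set q : ℝ := 1 / (1 - a) with hq
  have hq0 : 0 < q := by positivity
  have hIint := wn_rpow_integrable d u hu.continuous hc q hq0
  set I : ℝ := ∫ x, (u x ^ 2) ^ q with hI
  set G : EuclideanSpace ℝ (Fin d) → ℝ :=
    fun x => ∫ y, (u x - u y) ^ 2 / ‖x - y‖ ^ ((d : ℝ) + α) with hG
  have hG0 : ∀ x, 0 ≤ G x := fun x => integral_nonneg fun y => by positivity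
  have hGint : Integrable G := hK.integral_prod_left
  have hD : fracD d α u = ∫ x, G x := rfl
  have hD0 : 0 ≤ ∫ x, G x := integral_nonneg hG0
  have hI0 : 0 ≤ I := integral_nonneg fun x => by positivity
  rw [hD]
  rcases hI0.eq_or_lt with h0 | hIpos
  · rw [← h0, Real.zero_rpow h1a.ne']; positivity
  have hpt : ∀ x, (u x ^ 2) ^ q ≤ C * I ^ a * G x := by
    intro x
    refine hsc _ _ _ (sq_nonneg _) (hG0 x) hIpos fun t ht => ?_
    set r : ℝ := t ^ (1 / (d:ℝ)) with hr
    have hr0 : 0 < r := by positivity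
    have hrd : r ^ d = t := by
      rw [hr, ← Real.rpow_natCast, ← Real.rpow_mul ht.le, one_div_mul_cancel hd0.ne', Real.rpow_one]
    have hrda : r ^ ((d:ℝ) + α) = t ^ (1 + a) := by
      rw [hr, ← Real.rpow_mul ht.le]; congr 1; rw [ha]; field_simp
    have hvol : (volume : Measure (EuclideanSpace ℝ (Fin d))).real (Metric.ball x r) = ω * t := by
      rw [measureReal_def, Measure.addHaar_ball_of_pos volume x hr0, ENNReal.toReal_mul,
        ENNReal.toReal_ofReal (by positivity), hω, measureReal_def]
      simp [hrd, mul_comm]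
    have hfin : volume (Metric.ball x r) ≠ ⊤ := measure_ball_lt_top.ne
    have hu2 : Integrable (fun y => u y ^ 2) := by
      simpa using wn_rpow_integrable d u hu.continuous hc 1 one_pos
    have e1 : u x ^ 2 * (ω * t) = ∫ y in Metric.ball x r, u x ^ 2 := by
      rw [setIntegral_const, hvol, smul_eq_mul, mul_comm]
    have hle : ∫ y in Metric.ball x r, u x ^ 2 ≤ ∫ y in Metric.ball x r,
        (2 * (t ^ (1 + a) * ((u x - u y) ^ 2 / ‖x - y‖ ^ ((d : ℝ) + α))) + 2 * u y ^ 2) := by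
      refine setIntegral_mono_on (integrableOn_const hfin) ?_ measurableSet_ball fun y hy => ?_
      · exact ((((hKx x).const_mul _).const_mul 2).add (hu2.const_mul 2)).integrableOn
      · have hdist : ‖x - y‖ < r := by
          rw [← dist_eq_norm, dist_comm]; exact hy
        have h3 : (u x - u y) ^ 2 ≤ t ^ (1 + a) * ((u x - u y) ^ 2 / ‖x - y‖ ^ ((d : ℝ) + α)) := by
          by_cases hxy : x = y
          · subst hxy; simp
          · have hn : 0 < ‖x - y‖ := norm_pos_iff.2 (sub_ne_zero.2 hxy)
            rw [← mul_div_assoc, le_div_iff₀ (by positivity), mul_comm, ← hrda]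
            gcongr
        nlinarith [sq_nonneg (u x - 2 * u y)]
    have hG' : ∫ y in Metric.ball x r, (u x - u y) ^ 2 / ‖x - y‖ ^ ((d : ℝ) + α) ≤ G x :=
      setIntegral_le_integral (hKx x) (Filter.Eventually.of_forall fun y => by
        show 0 ≤ (u x - u y) ^ 2 / ‖x - y‖ ^ ((d : ℝ) + α)
        positivity)
    have hH : ∫ y in Metric.ball x r, u y ^ 2 ≤ (ω * t) ^ a * I ^ (1 - a) := by
      have h5 := wn_holder (μ := volume.restrict (Metric.ball x r)) (f := fun y => (u y ^ 2) ^ q)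
        (g := fun _ => (1:ℝ)) hIint.integrableOn (integrableOn_const hfin) (fun y => by positivity)
        (fun _ => one_pos.le) h1a ha0 (by ring)
      have h6 : ∀ y, ((u y ^ 2) ^ q) ^ (1 - a) * (1:ℝ) ^ a = u y ^ 2 := by
        intro y
        rw [← Real.rpow_mul (sq_nonneg _), hq, one_div_mul_cancel h1a.ne', Real.rpow_one,
          Real.one_rpow, mul_one]
      simp only [h6] at h5
      rw [setIntegral_const, hvol, smul_eq_mul, mul_one] at h5
      refine h5.trans ?_
      rw [mul_comm]
      have h7 : 0 ≤ ∫ y in Metric.ball x r, (u y ^ 2) ^ q := integral_nonneg fun y => by positivity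
      gcongr
      exact setIntegral_le_integral hIint (Filter.Eventually.of_forall fun y => by
        show 0 ≤ (u y ^ 2) ^ q
        positivity)
    rw [e1]
    refine hle.trans ?_
    rw [integral_add (((hKx x).const_mul _).const_mul 2).integrableOn (hu2.const_mul 2).integrableOn,
      integral_const_mul, integral_const_mul, integral_const_mul]
    gcongr
  have hIle : I ≤ C * I ^ a * ∫ x, G x := by
    rw [← integral_const_mul]
    exact integral_mono hIint (hGint.const_mul _) hpt
  rw [Real.rpow_sub hIpos, Real.rpow_one, div_le_iff₀ (by positivity)]
  linarith

theorem weighted_nash_inequality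
    (d : ℕ) (α β : ℝ) (hα : α ∈ Set.Ioo (0 : ℝ) 2) (hd : α < d) (hβ : α < β)
    (c₀ : ℝ) (hc₀ : 0 < c₀)
    (W : EuclideanSpace ℝ (Fin d) → ℝ) (hWmeas : Measurable W)
    (hWlb : ∀ x : EuclideanSpace ℝ (Fin d), c₀ * (1 + ‖x‖) ^ β ≤ W x) :
    ∃ C > (0 : ℝ), ∀ u : EuclideanSpace ℝ (Fin d) → ℝ,
      ContDiff ℝ (⊤ : ℕ∞) u → HasCompactSupport u →
        (∫ x, (u x) ^ 2 * (W x)⁻¹) ^ (((d : ℝ) + α) / (d : ℝ)) ≤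
          C * fracD d α u *
            (∫ x, |u x| * (1 + ‖x‖) ^ (-(β * ((d : ℝ) - α)) / (2 * α)) * (W x)⁻¹)
              ^ (2 * α / (d : ℝ)) := by
  obtain ⟨hα0, hα2⟩ := hα
  have hd0 : 0 < (d:ℝ) := hα0.trans hd
  have hβ0 : 0 < β := hα0.trans hβ
  have hda : 0 < (d:ℝ) - α := by linarith
  obtain ⟨C, hC, hS⟩ := wn_sobolev d α hα0 hα2 hd
  have h1a : 0 < 1 - α / d := by rw [sub_pos, div_lt_one hd0]; exact hd
  refine ⟨(c₀⁻¹) ^ (1 - α / d) * C, by positivity, fun u hu hc => ?_⟩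
  have hq0 : 0 < 1 / (1 - α / d) := by positivity
  have hIint := wn_rpow_integrable d u hu.continuous hc _ hq0
  have hSu := hS u hu hc
  have hqe : 1 / (1 - α / d) = d / (d - α) := by field_simp
  set q : ℝ := 1 / (1 - α / d) with hq
  have hn : ∀ x : EuclideanSpace ℝ (Fin d), 0 < 1 + ‖x‖ := fun x => by positivity
  have hW : ∀ x, 0 < W x := fun x =>
    (mul_pos hc₀ (Real.rpow_pos_of_pos (hn x) β)).trans_le (hWlb x)
  have hgW : ∀ x, (1 + ‖x‖) ^ β * (W x)⁻¹ ≤ c₀⁻¹ := by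
    intro x
    rw [← div_eq_mul_inv, div_le_iff₀ (hW x), ← div_eq_inv_mul, le_div_iff₀' hc₀]
    exact hWlb x
  have hhW : ∀ x, (1 + ‖x‖) ^ (-(β * ((d : ℝ) - α)) / (2 * α)) * (W x)⁻¹ ≤ c₀⁻¹ := by
    intro x
    refine le_trans ?_ (hgW x)
    have hx1 : 1 ≤ 1 + ‖x‖ := by linarith [norm_nonneg x]
    have := hW x
    gcongr
    · rw [neg_div]
      have : 0 ≤ β * ((d : ℝ) - α) / (2 * α) := by positivity
      linarith
  set f : EuclideanSpace ℝ (Fin d) → ℝ := fun x => (u x ^ 2) ^ q * ((1 + ‖x‖) ^ β * (W x)⁻¹) with hf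
  set g : EuclideanSpace ℝ (Fin d) → ℝ :=
    fun x => |u x| * (1 + ‖x‖) ^ (-(β * ((d : ℝ) - α)) / (2 * α)) * (W x)⁻¹ with hg
  have hf0 : ∀ x, 0 ≤ f x := fun x => by have := hW x; simp only [hf]; positivity
  have hg0 : ∀ x, 0 ≤ g x := fun x => by have := hW x; simp only [hg]; positivity
  have hum := hu.continuous.measurable
  have hfle : ∀ x, f x ≤ (u x ^ 2) ^ q * c₀⁻¹ := fun x =>
    mul_le_mul_of_nonneg_left (hgW x) (by positivity)
  have hfint : Integrable f := by
    refine (hIint.mul_const c₀⁻¹).mono' ?_ (Filter.Eventually.of_forall fun x => ?_)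
    · exact Measurable.aestronglyMeasurable (by fun_prop)
    · rw [Real.norm_of_nonneg (hf0 x)]; exact hfle x
  have hgint : Integrable g := by
    have hui : Integrable (fun x => |u x|) :=
      (hu.continuous.integrable_of_hasCompactSupport hc).abs
    refine (hui.mul_const c₀⁻¹).mono' ?_ (Filter.Eventually.of_forall fun x => ?_)
    · exact Measurable.aestronglyMeasurable (by fun_prop)
    · rw [Real.norm_of_nonneg (hg0 x)]
      simp only [hg]
      rw [mul_assoc]
      exact mul_le_mul_of_nonneg_left (hhW x) (abs_nonneg _)
  set a : ℝ := (d - α) / (d + α) with ha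
  set b : ℝ := 2 * α / (d + α) with hb
  have ha0 : 0 < a := by positivity
  have hb0 : 0 < b := by positivity
  have hab : a + b = 1 := by rw [ha, hb]; field_simp; ring
  have hH := wn_holder hfint hgint hf0 hg0 ha0 hb0 hab
  have hfg : ∀ x, f x ^ a * g x ^ b = u x ^ 2 * (W x)⁻¹ := by
    intro x
    have hw := inv_pos.2 (hW x)
    have hx := hn x
    simp only [hf, hg]
    rw [Real.mul_rpow (by positivity) (by positivity), Real.mul_rpow (by positivity) (by positivity),
      Real.mul_rpow (by positivity) (by positivity), Real.mul_rpow (by positivity) (by positivity),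
      ← Real.rpow_mul (by positivity), ← Real.rpow_mul (by positivity), ← Real.rpow_mul (by positivity)]
    have e1 : (W x)⁻¹ ^ a * (W x)⁻¹ ^ b = (W x)⁻¹ := by
      rw [← Real.rpow_add hw, hab, Real.rpow_one]
    have e2 : (1 + ‖x‖) ^ (β * a) * (1 + ‖x‖) ^ (-(β * ((d : ℝ) - α)) / (2 * α) * b) = 1 := by
      rw [← Real.rpow_add hx]
      have : β * a + -(β * ((d : ℝ) - α)) / (2 * α) * b = 0 := by
        rw [ha, hb]; field_simp; ring
      rw [this, Real.rpow_zero]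
    have e3 : (u x ^ 2) ^ (q * a) * |u x| ^ b = u x ^ 2 := by
      rw [← sq_abs, ← Real.rpow_natCast, ← Real.rpow_mul (abs_nonneg _),
        ← Real.rpow_add_of_nonneg (abs_nonneg _) (by positivity) hb0.le]
      congr 1
      rw [hqe, ha, hb]; push_cast; field_simp
    calc _ = ((u x ^ 2) ^ (q * a) * |u x| ^ b) *
          ((1 + ‖x‖) ^ (β * a) * (1 + ‖x‖) ^ (-(β * ((d : ℝ) - α)) / (2 * α) * b)) *
          ((W x)⁻¹ ^ a * (W x)⁻¹ ^ b) := by ring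
      _ = _ := by rw [e1, e2, e3, mul_one]
  simp only [hfg] at hH
  have hJ0 : 0 ≤ ∫ x, u x ^ 2 * (W x)⁻¹ := integral_nonneg fun x => by have := hW x; positivity
  have hF0 : 0 ≤ ∫ x, f x := integral_nonneg hf0
  have hGG0 : 0 ≤ ∫ x, g x := integral_nonneg hg0
  have hI0 : 0 ≤ ∫ x, (u x ^ 2) ^ q := integral_nonneg fun x => by positivity
  have hFI : ∫ x, f x ≤ c₀⁻¹ * ∫ x, (u x ^ 2) ^ q := by
    rw [mul_comm, ← integral_mul_const]
    exact integral_mono hfint (hIint.mul_const _) hfle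
  calc (∫ x, u x ^ 2 * (W x)⁻¹) ^ (((d : ℝ) + α) / (d : ℝ))
      ≤ ((∫ x, f x) ^ a * (∫ x, g x) ^ b) ^ (((d : ℝ) + α) / (d : ℝ)) := by gcongr
    _ = (∫ x, f x) ^ (1 - α / d) * (∫ x, g x) ^ (2 * α / (d:ℝ)) := by
        rw [Real.mul_rpow (by positivity) (by positivity), ← Real.rpow_mul hF0, ← Real.rpow_mul hGG0]
        congr 2
        · rw [ha]; field_simp
        · rw [hb]; field_simp
    _ ≤ (c₀⁻¹ * ∫ x, (u x ^ 2) ^ q) ^ (1 - α / d) * (∫ x, g x) ^ (2 * α / (d:ℝ)) := by gcongr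
    _ ≤ _ := by
        rw [Real.mul_rpow (by positivity) hI0, mul_assoc (c₀⁻¹ ^ (1 - α / (d:ℝ))) C]
        gcongr
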